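/- Let H ⊆ G be finite groups and V a faithful finite-dimensional complex representation of G. Then induction of representations [W] ↦ [Ind^G_H W] induces a well-defined group homomorphism \bar{Ind} : K(Res^G_H V) → K(V). Moreover, if the restriction map Res : R(G) → R(H) is surjective, then \bar{Ind} is injective. -/

import Mathlib

/- The representation ring `R(G)` of a finite group `G` is modeled as the ring of virtual
characters: the ℤ-span of the characters of finite-dimensional complex representations,
inside the ring `G → ℂ` (a faithful model in characteristic zero).  Under this
identification, multiplication by the class of a representation is pointwise
multiplication by its character, the dimension homomorphism is evaluation at `1`, and
restriction of representations is precomposition of characters. -/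

open CategoryTheory

noncomputable def repRing (G : Type) [Group G] [Fintype G] : Submodule ℤ (G → ℂ) :=
  Submodule.span ℤ {f | ∃ V : FDRep ℂ G, f = V.character}

/-- `R₀(G)`: virtual characters of virtual dimension `0`. -/
noncomputable def R0 (G : Type) [Group G] [Fintype G] : Submodule ℤ (G → ℂ) :=
  repRing G ⊓ LinearMap.ker
    (((LinearMap.proj (1 : G)) : (G → ℂ) →ₗ[ℂ] ℂ).restrictScalars ℤ)

/-- the "character" of the element `dim(V)·[1_G] − [V]`; multiplication by this function
is the map `C̃_V` (and `C_V`, on `R₀(G)`). -/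
noncomputable def cfun (G : Type) [Group G] [Fintype G] (χ : G → ℂ) : G → ℂ :=
  fun g => χ 1 - χ g

/-- the image of `C_V : R₀(G) → R₀(G)`, as a submodule of `R₀(G)`. -/
noncomputable def critIm (G : Type) [Group G] [Fintype G] (χ : G → ℂ) :
    Submodule ℤ (R0 G) :=
  (Submodule.map (LinearMap.mulLeft ℤ (cfun G χ)) (R0 G)).comap (R0 G).subtype

/-- the critical group `K(V) = coker(C_V : R₀(G) → R₀(G))`, where `χ = χ_V`. -/
noncomputable abbrev Kgroup (G : Type) [Group G] [Fintype G] (χ : G → ℂ) :=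
  R0 G ⧸ critIm G χ


open Classical in
/-- the induced character: for `f : H → ℂ`,
`(Ind f)(g) = |H|⁻¹ ∑_{x ∈ G} ḟ(x⁻¹ g x)` where `ḟ` extends `f` by zero off `H`. -/
noncomputable def indC (G : Type) [Group G] [Fintype G] (H : Subgroup G) [Fintype ↥H]
    (f : ↥H → ℂ) : G → ℂ :=
  fun g => (Fintype.card ↥H : ℂ)⁻¹ *
    ∑ x : G, ∑ h : ↥H, if (h : G) = x⁻¹ * g * x then f h else 0

/-- The bilinear pairing `⟨f, k⟩ = |G|⁻¹ ∑ g, f g * k g⁻¹` on functions `G → ℂ`. -/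
noncomputable def charPairing (G : Type*) [Group G] [Fintype G] :
    (G → ℂ) →ₗ[ℂ] (G → ℂ) →ₗ[ℂ] ℂ :=
  LinearMap.mk₂ ℂ (fun f k => (Nat.card G : ℂ)⁻¹ * ∑ g : G, f g * k g⁻¹)
    (fun f f' k => by simp only [Pi.add_apply, add_mul, Finset.sum_add_distrib, mul_add])
    (fun c f k => by
      simp only [Pi.smul_apply, smul_eq_mul, mul_assoc, ← Finset.mul_sum]; ring)
    (fun f k k' => by simp only [Pi.add_apply, Finset.sum_add_distrib, mul_add])
    (fun c f k => by
      simp only [Pi.smul_apply, smul_eq_mul, mul_left_comm _ c, ← Finset.mul_sum])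

theorem charPairing_apply {G : Type*} [Group G] [Fintype G] (f k : G → ℂ) :
    charPairing G f k = (Nat.card G : ℂ)⁻¹ * ∑ g : G, f g * k g⁻¹ := rfl

section IrreducibleCharacters

/-- The set of irreducible characters of `G`. -/
def irrChars (G : Type) [Group G] : Set (G → ℂ) :=
  {f | ∃ (W : Type) (_ : AddCommGroup W) (_ : Module ℂ W) (_ : FiniteDimensional ℂ W)
    (ρ : Representation ℂ G W), ρ.IsIrreducible ∧ f = ρ.character}

variable {G : Type} [Group G]

theorem Representation.character_eq_add_of_isCompl {W : Type*} [AddCommGroup W] [Module ℂ W]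
    [FiniteDimensional ℂ W] (ρ : Representation ℂ G W) {σ τ : Subrepresentation ρ}
    (h : IsCompl σ.toSubmodule τ.toSubmodule) :
    ρ.character = σ.toRepresentation.character + τ.toRepresentation.character := by
  ext g
  have key : ρ g = (Submodule.prodEquivOfIsCompl _ _ h).conj
      ((σ.toRepresentation g).prodMap (τ.toRepresentation g)) := by
    rw [LinearEquiv.conj_apply, LinearEquiv.eq_comp_toLinearMap_symm]
    ext x <;> simp <;> rfl
  rw [Pi.add_apply, Representation.character, key, LinearMap.trace_conj',
    LinearMap.trace_prodMap']
  rfl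

variable [Fintype G]

theorem Representation.character_mem_span_irrChars (n : ℕ) :
    ∀ (W : Type) [AddCommGroup W] [Module ℂ W] [FiniteDimensional ℂ W]
      (ρ : Representation ℂ G W), Module.finrank ℂ W = n →
      ρ.character ∈ Submodule.span ℤ (irrChars G) := by
  induction n using Nat.strong_induction_on with
  | _ n ih =>
  intro W _ _ _ ρ hn
  by_cases hirr : ρ.IsIrreducible
  · exact Submodule.subset_span ⟨W, _, _, ‹_›, ρ, hirr, rfl⟩
  rcases subsingleton_or_nontrivial W with hW | hW
  · have h0 : ρ.character = 0 := by
      ext g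
      have : ρ g = 0 := Subsingleton.elim _ _
      simp [Representation.character, this]
    rw [h0]
    exact zero_mem _
  have hnt : Nontrivial (Subrepresentation ρ) := by
    refine ⟨⊥, ⊤, fun h => ?_⟩
    exact bot_ne_top (α := Submodule ℂ W) (congrArg Subrepresentation.toSubmodule h)
  obtain ⟨σ, hσ⟩ : ∃ σ : Subrepresentation ρ, ¬ (σ = ⊥ ∨ σ = ⊤) := by
    by_contra! hcon
    exact hirr ⟨hcon⟩
  push Not at hσ
  obtain ⟨τ, hστ⟩ := exists_isCompl σ
  have hc : IsCompl σ.toSubmodule τ.toSubmodule := by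
    refine IsCompl.of_eq ?_ ?_
    · rw [← Subrepresentation.toSubmodule_inf, hστ.inf_eq_bot]; rfl
    · rw [← Subrepresentation.toSubmodule_sup, hστ.sup_eq_top]; rfl
  have hσ0 : σ.toSubmodule ≠ ⊥ := fun h => hσ.1 (Subrepresentation.toSubmodule_injective h)
  have hσ1 : σ.toSubmodule ≠ ⊤ := fun h => hσ.2 (Subrepresentation.toSubmodule_injective h)
  have hadd := Submodule.finrank_add_eq_of_isCompl hc
  have hlt := Submodule.finrank_lt hσ1
  have hpos : 0 < Module.finrank ℂ σ.toSubmodule :=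
    Module.finrank_pos_iff.mpr (Submodule.nontrivial_iff_ne_bot.mpr hσ0)
  rw [ρ.character_eq_add_of_isCompl hc]
  exact add_mem (ih _ (by omega) _ _ rfl) (ih _ (by omega) _ _ rfl)

theorem repRing_eq_span_irrChars : repRing G = Submodule.span ℤ (irrChars G) := by
  apply le_antisymm
  · refine Submodule.span_le.mpr ?_
    rintro _ ⟨V, rfl⟩
    exact Representation.character_mem_span_irrChars _ V V.ρ rfl
  · refine Submodule.span_mono ?_
    rintro _ ⟨W, _, _, _, ρ, -, rfl⟩
    exact ⟨FDRep.of ρ, rfl⟩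

open Classical in
theorem charPairing_irrChars {f k : G → ℂ} (hf : f ∈ irrChars G) (hk : k ∈ irrChars G) :
    charPairing G f k = if f = k then 1 else 0 := by
  obtain ⟨W, _, _, _, ρ, hρ, rfl⟩ := hf
  have hinv : Invertible (Nat.card G : ℂ) := invertibleOfNonzero (by simp)
  split_ifs with h
  · subst h
    rw [charPairing_apply, Representation.char_orthonormal, if_pos ⟨.refl _⟩]
  · obtain ⟨W', _, _, _, σ, hσ, rfl⟩ := hk
    rw [charPairing_apply, Representation.char_orthonormal, if_neg]
    rintro ⟨e⟩
    exact h (Representation.char_iso e).symm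

theorem charPairing_repRing {f k : G → ℂ} (hf : f ∈ repRing G) (hk : k ∈ repRing G) :
    ∃ n : ℤ, charPairing G f k = n := by
  classical
  rw [repRing_eq_span_irrChars] at hf hk
  induction hf, hk using Submodule.span_induction₂ with
  | mem_mem f k hf hk =>
    exact ⟨if f = k then 1 else 0, by rw [charPairing_irrChars hf hk]; split_ifs <;> simp⟩
  | zero_left => exact ⟨0, by simp⟩
  | zero_right => exact ⟨0, by simp⟩
  | add_left _ _ _ _ _ _ h₁ h₂ =>
    obtain ⟨a, ha⟩ := h₁
    obtain ⟨b, hb⟩ := h₂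
    exact ⟨a + b, by simp [ha, hb]⟩
  | add_right _ _ _ _ _ _ h₁ h₂ =>
    obtain ⟨a, ha⟩ := h₁
    obtain ⟨b, hb⟩ := h₂
    exact ⟨a + b, by simp [ha, hb]⟩
  | smul_left r _ _ _ _ h =>
    obtain ⟨a, ha⟩ := h
    exact ⟨r * a, by rw [map_zsmul, LinearMap.smul_apply, ha]; simp⟩
  | smul_right r _ _ _ _ h =>
    obtain ⟨a, ha⟩ := h
    exact ⟨r * a, by rw [map_zsmul, ha]; simp⟩

/-- A complex combination of characters whose pairings with all characters are integers is a
virtual character. -/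
theorem mem_repRing_of_charPairing_int {z : G → ℂ}
    (hz : z ∈ Submodule.span ℂ (repRing G : Set (G → ℂ)))
    (hint : ∀ k ∈ repRing G, ∃ n : ℤ, charPairing G z k = n) : z ∈ repRing G := by
  classical
  have hz' : z ∈ Submodule.span ℂ (irrChars G) := by
    rwa [repRing_eq_span_irrChars, Submodule.span_span_of_tower] at hz
  obtain ⟨c, rfl⟩ := (Finsupp.mem_span_iff_linearCombination ℂ _ _).mp hz'
  rw [Finsupp.linearCombination_apply, Finsupp.sum] at hint ⊢
  have hirr : ∀ i : irrChars G, (i : G → ℂ) ∈ repRing G := fun i => by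
    rw [repRing_eq_span_irrChars]; exact Submodule.subset_span i.2
  refine Submodule.sum_mem _ fun j hj => ?_
  obtain ⟨n, hn⟩ := hint j (hirr j)
  have : c j = n := by
    rw [← hn, map_sum, LinearMap.sum_apply, Finset.sum_eq_single j]
    · simp [charPairing_irrChars j.2 j.2]
    · intro i _ hij
      simp [charPairing_irrChars i.2 j.2, Subtype.coe_injective.ne hij]
    · intro h
      exact absurd hj h
  rw [this]
  have : (n : ℂ) • (j : G → ℂ) = n • (j : G → ℂ) := by ext; simp
  rw [this]
  exact Submodule.smul_mem _ _ (hirr j)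

theorem repRing_conj {f : G → ℂ} (hf : f ∈ repRing G) (g x : G) : f (x * g * x⁻¹) = f g := by
  induction hf using Submodule.span_induction with
  | mem f hf => obtain ⟨V, rfl⟩ := hf; exact V.char_conj g x
  | zero => rfl
  | add f k _ _ h₁ h₂ => simp [h₁, h₂]
  | smul r f _ h => simp [h]

theorem mul_mem_repRing {f k : G → ℂ} (hf : f ∈ repRing G) (hk : k ∈ repRing G) :
    f * k ∈ repRing G := by
  induction hf, hk using Submodule.span_induction₂ with
  | mem_mem f k hf hk =>
    obtain ⟨V, rfl⟩ := hf
    obtain ⟨W, rfl⟩ := hk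
    exact Submodule.subset_span ⟨FDRep.of (Representation.tprod V.ρ W.ρ),
      (Representation.char_tensor V.ρ W.ρ).symm⟩
  | zero_left => simp
  | zero_right => simp
  | add_left _ _ _ _ _ _ h₁ h₂ => rw [add_mul]; exact add_mem h₁ h₂
  | add_right _ _ _ _ _ _ h₁ h₂ => rw [mul_add]; exact add_mem h₁ h₂
  | smul_left r _ _ _ _ h => rw [smul_mul_assoc]; exact Submodule.smul_mem _ _ h
  | smul_right r _ _ _ _ h => rw [mul_smul_comm]; exact Submodule.smul_mem _ _ h

theorem one_mem_repRing : (1 : G → ℂ) ∈ repRing G :=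
  Submodule.subset_span ⟨FDRep.of (Representation.trivial ℂ G ℂ), by
    ext g
    change 1 = LinearMap.trace ℂ ℂ (Representation.trivial ℂ G ℂ g)
    simp⟩

/-- The complex span of the characters is closed under division by a nowhere vanishing virtual
character. -/
theorem div_mem_span_repRing {a b : G → ℂ} (ha : a ∈ repRing G) (ha0 : ∀ g, a g ≠ 0)
    (hb : b ∈ repRing G) : b / a ∈ Submodule.span ℂ (repRing G : Set (G → ℂ)) := by
  set A := Submodule.span ℂ (repRing G : Set (G → ℂ))
  have hmul : ∀ f ∈ A, LinearMap.mulLeft ℂ a f ∈ A := by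
    intro f hf
    induction hf using Submodule.span_induction with
    | mem f hf => exact Submodule.subset_span (mul_mem_repRing ha hf)
    | zero => simp
    | add f k _ _ h₁ h₂ => rw [map_add]; exact add_mem h₁ h₂
    | smul r f _ h => rw [map_smul]; exact Submodule.smul_mem _ _ h
  have hinj : Function.Injective ((LinearMap.mulLeft ℂ a).restrict hmul) := by
    intro f k h
    ext g
    have := congrFun (congrArg Subtype.val h) g
    exact mul_left_cancel₀ (ha0 g) this
  obtain ⟨c, hc⟩ := LinearMap.injective_iff_surjective.mp hinj ⟨b, Submodule.subset_span hb⟩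
  have : b / a = c := by
    ext g
    have : a g * (c : G → ℂ) g = b g := congrFun (congrArg Subtype.val hc) g
    rw [Pi.div_apply, ← this, mul_div_cancel_left₀ _ (ha0 g)]
  rw [this]
  exact c.2

end IrreducibleCharacters

section Faithful

open Polynomial in
/-- An endomorphism of finite order whose trace equals the dimension is the identity. -/
theorem LinearMap.eq_one_of_pow_eq_one_of_trace_eq {W : Type*} [AddCommGroup W] [Module ℂ W]
    [FiniteDimensional ℂ W] (f : W →ₗ[ℂ] W) {n : ℕ} (hn : n ≠ 0) (hf : f ^ n = 1)
    (htr : LinearMap.trace ℂ W f = Module.finrank ℂ W) : f = 1 := by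
  have hsplit : f.charpoly.Splits := IsAlgClosed.splits _
  have hcard : f.charpoly.roots.card = Module.finrank ℂ W := by
    rw [← hsplit.natDegree_eq_card_roots, LinearMap.charpoly_natDegree]
  have hnorm : ∀ μ ∈ f.charpoly.roots, ‖μ‖ = 1 := by
    intro μ hμ
    have hev : Module.End.HasEigenvalue f μ := by
      rw [Module.End.hasEigenvalue_iff_isRoot_charpoly]
      exact (mem_roots'.mp hμ).2
    obtain ⟨v, hv⟩ := hev.exists_hasEigenvector
    have h1 := hv.pow_apply n
    rw [hf, Module.End.one_apply] at h1
    refine Complex.norm_eq_one_of_pow_eq_one ?_ hn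
    refine smul_left_injective ℂ hv.2 ?_
    simpa using h1.symm
  have hsum : (f.charpoly.roots.map fun μ => 1 - μ.re).sum = 0 := by
    have h2 : f.charpoly.roots.sum = Module.finrank ℂ W := by
      rw [← htr, LinearMap.trace_eq_matrix_trace ℂ (Module.finBasis ℂ W),
        Matrix.trace_eq_sum_roots_charpoly, LinearMap.charpoly_toMatrix]
    have h3 := congrArg Complex.reAddGroupHom h2
    rw [map_multiset_sum] at h3
    rw [Multiset.sum_map_sub, Multiset.map_const', Multiset.sum_replicate, hcard]
    simp at h3 ⊢
    linarith
  have hroots : ∀ μ ∈ f.charpoly.roots, μ = 1 := by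
    intro μ hμ
    have hnn : ∀ x ∈ f.charpoly.roots.map fun μ => 1 - μ.re, (0 : ℝ) ≤ x := by
      intro x hx
      obtain ⟨ν, hν, rfl⟩ := Multiset.mem_map.mp hx
      have := Complex.re_le_norm ν
      rw [hnorm ν hν] at this
      linarith
    have h0 : 1 - μ.re = 0 := Multiset.all_zero_of_le_zero_le_of_sum_eq_zero hnn hsum _
      (Multiset.mem_map_of_mem _ hμ)
    have hre : μ.re = 1 := by linarith
    have him : μ.im = 0 := by
      have := Complex.sq_norm μ
      rw [hnorm μ hμ, Complex.normSq_apply, hre] at this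
      nlinarith
    exact Complex.ext (by simpa using hre) (by simpa using him)
  have hcp : f.charpoly = (X - C 1) ^ Module.finrank ℂ W := by
    rw [hsplit.eq_prod_roots_of_monic f.charpoly_monic,
      Multiset.eq_replicate.mpr ⟨hcard, hroots⟩]
    simp
  have hnil : IsNilpotent (f - 1) := by
    refine ⟨Module.finrank ℂ W, ?_⟩
    have := f.aeval_self_charpoly
    rw [hcp] at this
    simpa using this
  have hss : Module.End.IsSemisimple f := by
    refine Module.End.isSemisimple_of_squarefree_aeval_eq_zero (p := X ^ n - C 1) ?_ (by simp [hf])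
    exact (separable_X_pow_sub_C (1 : ℂ) (by exact_mod_cast hn) one_ne_zero).squarefree
  have hss1 : Module.End.IsSemisimple (f - 1) :=
    hss.sub_of_commute (Commute.one_right f) Module.End.isSemisimple_id
  exact sub_eq_zero.mp (Module.End.eq_zero_of_isNilpotent_isSemisimple hnil hss1)

theorem cfun_ne_zero_of_faithful {G : Type} [Group G] [Fintype G] (V : FDRep ℂ G)
    (hV : Function.Injective V.ρ) {g : G} (hg : g ≠ 1) : cfun G V.character g ≠ 0 := by
  intro h
  refine hg (hV ?_)
  rw [map_one]
  refine LinearMap.eq_one_of_pow_eq_one_of_trace_eq (V.ρ g) (orderOf_pos g).ne' ?_ ?_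
  · rw [← map_pow, pow_orderOf_eq_one, map_one]
  · rw [← FDRep.char_one]
    exact (sub_eq_zero.mp h).symm

end Faithful

section Induction

variable {G : Type} [Group G] {H : Subgroup G}

section InducedRepresentation

variable {W : Type} [AddCommGroup W] [Module ℂ W]

/-- The action of `H` on functions `G → W` given by `(h • φ) x = ρ h (φ (x * h))`. -/
def Representation.twistedRightRegular (ρ : Representation ℂ H W) :
    Representation ℂ H (G → W) where
  toFun h :=
    { toFun := fun φ x => ρ h (φ (x * h))
      map_add' := fun φ φ' => by ext; simp
      map_smul' := fun c φ => by ext; simp }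
  map_one' := by ext; simp
  map_mul' h k := by
    refine LinearMap.ext fun φ => funext fun x => ?_
    simp [mul_assoc]

/-- The representation of `G` induced from `ρ`, realized as left translation on the functions
`G → W` which are invariant under `Representation.twistedRightRegular ρ`. -/
noncomputable def Representation.inducedOnFunctions (ρ : Representation ℂ H W) :
    Representation ℂ G ρ.twistedRightRegular.invariants where
  toFun g := (LinearMap.funLeft ℂ W fun x => g⁻¹ * x).restrict fun φ hφ h => by
    ext x
    simpa [Representation.twistedRightRegular, mul_assoc] using congrFun (hφ h) (g⁻¹ * x)
  map_one' := by
    ext; simp [LinearMap.funLeft]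
  map_mul' g g' := by
    refine LinearMap.ext fun φ => Subtype.ext (funext fun x => ?_)
    change (φ : G → W) ((g * g')⁻¹ * x) = (φ : G → W) (g'⁻¹ * (g⁻¹ * x))
    rw [mul_inv_rev, mul_assoc]

end InducedRepresentation

variable [Fintype G] [Fintype H]

theorem Representation.char_inducedOnFunctions {W : Type} [AddCommGroup W] [Module ℂ W]
    [FiniteDimensional ℂ W] (ρ : Representation ℂ H W) :
    ρ.inducedOnFunctions.character = indC G H ρ.character := by
  classical
  ext g
  have hinv : Invertible (Fintype.card H : ℂ) := invertibleOfNonzero (by simp)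
  have hproj := ρ.twistedRightRegular.isProj_averageMap
  set L : (G → W) →ₗ[ℂ] (G → W) := LinearMap.funLeft ℂ W fun x => g⁻¹ * x
  have h1 : ρ.inducedOnFunctions g =
      (hproj.codRestrict ∘ₗ L) ∘ₗ ρ.twistedRightRegular.invariants.subtype := by
    refine LinearMap.ext fun φ => ?_
    exact (hproj.codRestrict_apply_cod (ρ.inducedOnFunctions g φ)).symm
  have h2 : ρ.twistedRightRegular.invariants.subtype ∘ₗ (hproj.codRestrict ∘ₗ L) =
      (Fintype.card H : ℂ)⁻¹ • ∑ x : G, ∑ h : H,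
        LinearMap.single ℂ (fun _ : G => W) x ∘ₗ (ρ h ∘ₗ LinearMap.proj (g⁻¹ * x * h)) := by
    rw [← LinearMap.comp_assoc, hproj.subtype_comp_codRestrict]
    refine LinearMap.ext fun φ => funext fun y => ?_
    simp [Representation.averageMap, GroupAlgebra.average, L, LinearMap.funLeft_apply,
      Representation.twistedRightRegular, Finset.sum_apply, Pi.single_apply, mul_assoc]
  rw [Representation.character, h1, LinearMap.trace_comp_comm', h2, map_smul, map_sum, indC,
    smul_eq_mul]
  congr 1
  refine Finset.sum_congr rfl fun x _ => ?_
  rw [map_sum]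
  refine Finset.sum_congr rfl fun h _ => ?_
  rw [LinearMap.trace_comp_comm', LinearMap.comp_assoc]
  have hiff : (h : G) = x⁻¹ * g * x ↔ g⁻¹ * x * h = x := by
    constructor
    · intro e; rw [e]; group
    · intro e
      rw [mul_assoc, inv_mul_eq_iff_eq_mul] at e
      rw [mul_assoc, ← e, inv_mul_cancel_left]
  split_ifs with e
  · rw [hiff.mp e, LinearMap.proj_comp_single_same, LinearMap.comp_id]
    rfl
  · rw [LinearMap.proj_comp_single_ne, LinearMap.comp_zero, map_zero]
    exact fun e' => e (hiff.mpr e')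

/-- Induction of functions as a linear map. -/
noncomputable def indLinear (H : Subgroup G) [Fintype H] : (H → ℂ) →ₗ[ℂ] (G → ℂ) where
  toFun := indC G H
  map_add' f k := by
    ext g
    simp only [indC, Pi.add_apply, ← mul_add, ← Finset.sum_add_distrib]
    congr 1
    refine Finset.sum_congr rfl fun x _ => Finset.sum_congr rfl fun h _ => ?_
    split_ifs <;> simp
  map_smul' c f := by
    ext g
    simp only [indC, Pi.smul_apply, smul_eq_mul, RingHom.id_apply, mul_left_comm c,
      Finset.mul_sum, mul_ite, mul_zero]

theorem indC_mem_repRing {f : H → ℂ} (hf : f ∈ repRing H) : indC G H f ∈ repRing G := by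
  change (indLinear H).restrictScalars ℤ f ∈ _
  refine Submodule.span_induction (p := fun f _ => (indLinear H).restrictScalars ℤ f ∈ repRing G)
    ?_ ?_ ?_ ?_ hf
  · rintro _ ⟨V, rfl⟩
    exact Submodule.subset_span ⟨FDRep.of (Representation.inducedOnFunctions V.ρ),
      (Representation.char_inducedOnFunctions V.ρ).symm⟩
  · rw [map_zero]; exact zero_mem _
  · intro f k _ _ h₁ h₂
    rw [map_add]; exact add_mem h₁ h₂
  · intro r f _ h
    rw [map_smul]; exact Submodule.smul_mem _ _ h

theorem indC_one {f : H → ℂ} (hf : f 1 = 0) : indC G H f 1 = 0 := by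
  rw [indC, Finset.sum_eq_zero fun x _ => Finset.sum_eq_zero fun h _ => ?_, mul_zero]
  split_ifs with e
  · rw [show h = 1 from Subtype.ext (by simpa using e), hf]
  · rfl

theorem indC_eq_zero {g : G} (hg : ∀ x : G, x⁻¹ * g * x ∉ H) (f : H → ℂ) :
    indC G H f g = 0 := by
  rw [indC, Finset.sum_eq_zero fun x _ => Finset.sum_eq_zero fun h _ => ?_, mul_zero]
  exact if_neg fun e : h.1 = x⁻¹ * g * x => hg x (e ▸ h.2)

theorem indC_conj (f : H → ℂ) (g x : G) : indC G H f (x⁻¹ * g * x) = indC G H f g := by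
  simp only [indC]
  congr 1
  refine Fintype.sum_equiv (Equiv.mulLeft x) _ _ fun y => ?_
  dsimp only [Equiv.coe_mulLeft]
  rw [show y⁻¹ * (x⁻¹ * g * x) * y = (x * y)⁻¹ * g * (x * y) by group]

/-- The projection formula. -/
theorem indC_mul_res {c : G → ℂ} (hc : ∀ g x : G, c (x * g * x⁻¹) = c g) (f : H → ℂ) :
    indC G H (fun h => c h * f h) = c * indC G H f := by
  ext g
  simp only [indC, Pi.mul_apply, mul_left_comm (c g), Finset.mul_sum]
  refine Finset.sum_congr rfl fun x _ => Finset.sum_congr rfl fun h _ => ?_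
  split_ifs with e
  · rw [e, show x⁻¹ * g * x = x⁻¹ * g * x⁻¹⁻¹ by simp, hc]
  · simp

/-- Frobenius reciprocity. -/
theorem charPairing_indC (f : H → ℂ) {k : G → ℂ} (hk : ∀ g x : G, k (x * g * x⁻¹) = k g) :
    charPairing G (indC G H f) k = charPairing H f fun h => k h := by
  classical
  have hsum : ∑ g : G, (∑ x : G, ∑ h : H, if (h : G) = x⁻¹ * g * x then f h else 0) * k g⁻¹ =
      Fintype.card G * ∑ h : H, f h * k (h⁻¹ : H) := by
    simp only [Finset.sum_mul]
    rw [Finset.sum_comm, ← nsmul_eq_mul, ← Finset.card_univ, ← Finset.sum_const]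
    refine Finset.sum_congr rfl fun x _ => ?_
    rw [Finset.sum_comm]
    refine Finset.sum_congr rfl fun h _ => ?_
    rw [Finset.sum_eq_single (x * h * x⁻¹)]
    · rw [if_pos (by group), ← hk (h⁻¹ : H) x]
      simp [mul_assoc]
    · intro g _ hg
      rw [if_neg, zero_mul]
      rintro e
      exact hg (by rw [e]; group)
    · simp
  simp only [charPairing_apply, indC, mul_assoc (_⁻¹ : ℂ), ← Finset.mul_sum, Nat.card_eq_fintype_card]
  rw [hsum]
  have : (Fintype.card G : ℂ) ≠ 0 := by simp
  field_simp

theorem indC_one_apply_ne_zero (h : H) : indC G H 1 h ≠ 0 := by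
  classical
  refine mul_ne_zero (by simp) ?_
  have : (∑ x : G, ∑ k : H, if (k : G) = x⁻¹ * h * x then (1 : H → ℂ) k else 0) =
      ((∑ x : G, ∑ k : H, if (k : G) = x⁻¹ * h * x then 1 else 0 : ℕ) : ℂ) := by
    push_cast
    rfl
  rw [this, Nat.cast_ne_zero]
  refine (Finset.sum_pos' (fun _ _ => Nat.zero_le _) ⟨1, Finset.mem_univ _, ?_⟩).ne'
  exact Finset.sum_pos' (fun _ _ => Nat.zero_le _) ⟨h, Finset.mem_univ _, by simp⟩

/-- At a point of `H` where `f` is constant on the `G`-conjugates lying in `H`, inducing `f` and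
restricting multiplies it by the character induced from the trivial one. -/
theorem indC_apply_coe {f : H → ℂ} {h : H}
    (hf : ∀ (x : G) (k : H), (k : G) = x⁻¹ * h * x → f k = f h) :
    indC G H f h = f h * indC G H 1 h := by
  simp only [indC, mul_left_comm (f h), Finset.mul_sum]
  refine Finset.sum_congr rfl fun x _ => Finset.sum_congr rfl fun k _ => ?_
  split_ifs with e
  · simp [hf x k e]
  · simp

theorem apply_eq_of_restriction_surjective
    (hres : ∀ f ∈ repRing H, ∃ x ∈ repRing G, ∀ h : H, x ↑h = f h) {f : H → ℂ}
    (hf : f ∈ Submodule.span ℂ (repRing H : Set (H → ℂ))) {h k : H} {x : G}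
    (hk : (k : G) = x⁻¹ * h * x) : f k = f h := by
  induction hf using Submodule.span_induction with
  | mem f hf =>
    obtain ⟨y, hy, hyf⟩ := hres f hf
    rw [← hyf, ← hyf, hk, show x⁻¹ * (h : G) * x = x⁻¹ * h * x⁻¹⁻¹ by simp, repRing_conj hy]
  | zero => rfl
  | add f k _ _ h₁ h₂ => simp [h₁, h₂]
  | smul r f _ h => simp [h]

theorem restrict_mem_repRing {f : G → ℂ} (hf : f ∈ repRing G) :
    (fun h : H => f h) ∈ repRing H := by
  induction hf using Submodule.span_induction with
  | mem f hf =>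
    obtain ⟨V, rfl⟩ := hf
    exact Submodule.subset_span ⟨FDRep.of (V.ρ.comp H.subtype), rfl⟩
  | zero => exact zero_mem _
  | add f k _ _ h₁ h₂ => exact add_mem h₁ h₂
  | smul r f _ h => exact Submodule.smul_mem _ r h

/-- If restriction is surjective and the virtual character `u` of `G` vanishes off the conjugates
of `H`, then `Res u / Res (Ind 1)`, which induces to `u`, is a virtual character of `H`. -/
theorem div_mem_repRing_of_restriction_surjective
    (hres : ∀ f ∈ repRing H, ∃ x ∈ repRing G, ∀ h : H, x ↑h = f h) {u : G → ℂ}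
    (hu : u ∈ repRing G) (hvan : ∀ g : G, (∀ x : G, x⁻¹ * g * x ∉ H) → u g = 0) :
    (fun h : H => u h / indC G H 1 h) ∈ repRing H := by
  have hspan : (fun h : H => u h / indC G H 1 h) ∈
      Submodule.span ℂ (repRing H : Set (H → ℂ)) :=
    div_mem_span_repRing (restrict_mem_repRing (indC_mem_repRing one_mem_repRing))
      indC_one_apply_ne_zero (restrict_mem_repRing hu)
  have hind : indC G H (fun h : H => u h / indC G H 1 h) = u := by
    ext g
    by_cases hg : ∀ x : G, x⁻¹ * g * x ∉ H
    · rw [indC_eq_zero hg, hvan g hg]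
    · push Not at hg
      obtain ⟨x, hx⟩ := hg
      have key := indC_apply_coe (f := fun h : H => u h / indC G H 1 h) (h := ⟨_, hx⟩)
        fun y k hk => apply_eq_of_restriction_surjective hres hspan hk
      rw [div_mul_cancel₀ _ (indC_one_apply_ne_zero _), indC_conj] at key
      simpa using key.trans (repRing_conj hu g x⁻¹ ▸ by simp)
  refine mem_repRing_of_charPairing_int hspan fun k hk => ?_
  obtain ⟨y, hy, hyk⟩ := hres k hk
  rw [← funext hyk, ← charPairing_indC _ (repRing_conj hy), hind]
  exact charPairing_repRing hu hy

theorem mem_R0_iff {f : G → ℂ} : f ∈ R0 G ↔ f ∈ repRing G ∧ f 1 = 0 := Iff.rfl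

theorem mem_critIm_iff {χ : G → ℂ} {y : R0 G} :
    y ∈ critIm G χ ↔ ∃ z ∈ R0 G, cfun G χ * z = y := Iff.rfl

/-- Induction as a map `R₀(H) → R₀(G)`. -/
noncomputable def indR0 (H : Subgroup G) [Fintype H] : R0 H →ₗ[ℤ] R0 G :=
  ((indLinear H).restrictScalars ℤ).restrict fun _ hf =>
    ⟨indC_mem_repRing hf.1, indC_one hf.2⟩

theorem coe_indR0 (y : R0 H) : (indR0 H y : G → ℂ) = indC G H y := rfl

theorem cfun_conj (V : FDRep ℂ G) (g x : G) :
    cfun G V.character (x * g * x⁻¹) = cfun G V.character g := by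
  rw [cfun, FDRep.char_conj, cfun]

theorem critIm_le_comap_indR0 (V : FDRep ℂ G) :
    critIm H (fun h : H => V.character h) ≤ (critIm G V.character).comap (indR0 H) := by
  intro y hy
  obtain ⟨z, hz, hzy⟩ := mem_critIm_iff.mp hy
  refine mem_critIm_iff.mpr ⟨indR0 H ⟨z, hz⟩, (indR0 H ⟨z, hz⟩).2, ?_⟩
  rw [coe_indR0, coe_indR0, ← hzy, ← indC_mul_res (cfun_conj V)]
  rfl

theorem comap_indR0_le_critIm (V : FDRep ℂ G) (hV : Function.Injective V.ρ)
    (hres : ∀ f ∈ repRing H, ∃ x ∈ repRing G, ∀ h : H, x ↑h = f h) :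
    (critIm G V.character).comap (indR0 H) ≤ critIm H (fun h : H => V.character h) := by
  intro y hy
  obtain ⟨u, hu, huy⟩ := mem_critIm_iff.mp hy
  rw [coe_indR0] at huy
  have hvan : ∀ g : G, (∀ x : G, x⁻¹ * g * x ∉ H) → u g = 0 := by
    intro g hg
    have hg1 : g ≠ 1 := by
      rintro rfl
      exact hg 1 (by simp)
    have := congrFun huy g
    rw [indC_eq_zero hg] at this
    exact (mul_eq_zero.mp this).resolve_left (cfun_ne_zero_of_faithful V hV hg1)
  refine mem_critIm_iff.mpr ⟨fun h => u h / indC G H 1 h,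
    ⟨div_mem_repRing_of_restriction_surjective hres hu.1 hvan, ?_⟩, ?_⟩
  · change u 1 / _ = 0
    rw [show u 1 = 0 from hu.2, zero_div]
  · ext h
    have key := indC_apply_coe (f := y) (h := h) fun x k hk =>
      apply_eq_of_restriction_surjective hres (Submodule.subset_span y.2.1) hk
    rw [← huy] at key
    change cfun G V.character h * (u h / _) = _
    rw [← mul_div_assoc, div_eq_iff (indC_one_apply_ne_zero h), ← key]
    rfl

end Induction

/-- Proposition 3.4 of the paper.  Let `H ⊆ G` be finite groups and
`V` a faithful finite-dimensional complex representation of `G`.  Induction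
`[W] ↦ [Ind^G_H W]` induces a well-defined group homomorphism
`\bar{Ind} : K(Res^G_H V) → K(V)`, and if `Res : R(G) → R(H)` is surjective then
`\bar{Ind}` is injective. -/
theorem stmt6 (G : Type) [Group G] [Fintype G] (H : Subgroup G) [Fintype ↥H]
    (V : FDRep ℂ G) (hfaithful : Function.Injective V.ρ) :
    ∃ ψ : Kgroup H (fun h : H => V.character ↑h) →+ Kgroup G V.character,
      -- `ψ = \bar{Ind}` is induced by `[W] ↦ [Ind^G_H W]`, i.e. by `f ↦ Ind f` on
      -- virtual characters
      (∀ (y : R0 H) (x : R0 G), (x : G → ℂ) = indC G H (y : ↥H → ℂ) →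
          ψ (Submodule.Quotient.mk y) = Submodule.Quotient.mk x) ∧
      -- if `Res : R(G) → R(H)` is surjective, then `\bar{Ind}` is injective
      ((∀ f ∈ repRing H, ∃ x ∈ repRing G, ∀ h : H, x ↑h = f h) →
        Function.Injective ψ) := by
  refine ⟨((critIm H _).mapQ _ (indR0 H) (critIm_le_comap_indR0 V)).toAddMonoidHom, ?_, ?_⟩
  · intro y x hxy
    rw [show x = indR0 H y from Subtype.ext hxy]
    rfl
  · intro hres
    refine (injective_iff_map_eq_zero _).mpr fun q hq => ?_
    obtain ⟨y, rfl⟩ := Submodule.Quotient.mk_surjective _ q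
    have hy : Submodule.Quotient.mk (p := critIm G V.character) (indR0 H y) = 0 := hq
    rw [Submodule.Quotient.mk_eq_zero] at hy ⊢
    exact comap_indR0_le_critIm V hfaithful hres hy
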